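/- The map ε(F) := F ∩ E restricts to a bijection from the set of idempotent ultrafilters of S onto the set of E-ultrafilters; in particular, for every idempotent ultrafilter U of S the set U ∩ E is an E-ultrafilter, and every E-ultrafilter arises as U ∩ E for a unique idempotent ultrafilter U. -/

import Mathlib

/-- An inverse semigroup with zero: every element `a` has a unique `a⁻¹` with
`a * a⁻¹ * a = a` and `a⁻¹ * a * a⁻¹ = a⁻¹`, and `0` is absorbing. -/
class InvSemigroupWithZero (S : Type*) extends Semigroup S, Zero S, Inv S where
  mul_inv_mul : ∀ a : S, a * a⁻¹ * a = a
  inv_mul_inv : ∀ a : S, a⁻¹ * a * a⁻¹ = a⁻¹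
  inv_unique : ∀ a b : S, a * b * a = a → b * a * b = b → b = a⁻¹
  zero_mul : ∀ a : S, 0 * a = 0
  mul_zero : ∀ a : S, a * 0 = 0

namespace InvSemigroupWithZero

variable {S : Type*} [InvSemigroupWithZero S]

/-- The natural partial order on `S`: `a ≤ b` iff `a = a * a⁻¹ * b`. -/
def sle (a b : S) : Prop := a = a * a⁻¹ * b

/-- `↓s`, the down-set of `s` w.r.t. the natural partial order. -/
def dwn (s : S) : Set S := {t : S | sle t s}

/-- `↑A`, the up-set generated by `A` w.r.t. the natural partial order. -/
def up (A : Set S) : Set S := {b : S | ∃ a ∈ A, sle a b}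

/-- A filter in `S`: a nonempty down-directed up-set. -/
def IsFilt (F : Set S) : Prop :=
  F.Nonempty ∧ up F = F ∧ ∀ a ∈ F, ∀ b ∈ F, ∃ c ∈ F, sle c a ∧ sle c b

/-- A proper filter: a filter not containing `0`. -/
def IsPFilt (F : Set S) : Prop := IsFilt F ∧ (0 : S) ∉ F

/-- An ultrafilter: a proper filter maximal among proper filters. -/
def IsUltra (U : Set S) : Prop :=
  IsPFilt U ∧ ∀ G : Set S, IsPFilt G → U ⊆ G → U = G

/-- The set `E` of idempotents of `S`. -/
def E (S : Type*) [InvSemigroupWithZero S] : Set S := {e : S | e * e = e}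

/-- `F⁻¹ = {a⁻¹ : a ∈ F}`. -/
def finv (F : Set S) : Set S := (fun a : S => a⁻¹) '' F

/-- `F · G = ↑{fg : f ∈ F, g ∈ G}`. -/
def fmul (F G : Set S) : Set S := up (Set.image2 (· * ·) F G)

/-- The source `d(F) := F⁻¹ · F`. -/
def src (F : Set S) : Set S := fmul (finv F) F

/-- The range `r(F) := F · F⁻¹`. -/
def rng (F : Set S) : Set S := fmul F (finv F)

/-- The natural partial order on the idempotents: `e ≤ f` iff `e = e * f`. -/
def ele (e f : S) : Prop := e = e * f

/-- The down-set of an idempotent `e` inside `E`. -/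
def edwn (e : S) : Set S := {f : S | f ∈ E S ∧ ele f e}

/-- The up-set generated by `A` inside `E`. -/
def eup (A : Set S) : Set S := {f : S | f ∈ E S ∧ ∃ a ∈ A, ele a f}

/-- An `E`-filter: a proper filter of the inverse semigroup `E` of idempotents. -/
def IsEFilt (ξ : Set S) : Prop :=
  ξ ⊆ E S ∧ ξ.Nonempty ∧ eup ξ = ξ ∧
    (∀ a ∈ ξ, ∀ b ∈ ξ, ∃ c ∈ ξ, ele c a ∧ ele c b) ∧ (0 : S) ∉ ξ

/-- An `E`-ultrafilter: an `E`-filter maximal among `E`-filters. -/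
def IsEUltra (ξ : Set S) : Prop :=
  IsEFilt ξ ∧ ∀ η : Set S, IsEFilt η → ξ ⊆ η → ξ = η

/-- `β_s(ξ) = {f ∈ E : s·e·s⁻¹ ≤ f for some e ∈ ξ}`. -/
def beta (s : S) (ξ : Set S) : Set S :=
  {f : S | f ∈ E S ∧ ∃ e ∈ ξ, sle (s * e * s⁻¹) f}

/-- The set of proper filters in `S`. -/
abbrev PFilt (S : Type*) [InvSemigroupWithZero S] := {F : Set S // IsPFilt F}

/-- The patch topology on the set of proper filters, generated by the sets
`F(s;T) = {F : s ∈ F, F ∩ T = ∅}` for `s ∈ S` and finite `T ⊆ ↓s`. -/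
instance patchTopology : TopologicalSpace (PFilt S) :=
  TopologicalSpace.generateFrom
    {O : Set (PFilt S) | ∃ (s : S) (T : Set S), T.Finite ∧ T ⊆ dwn s ∧
      O = {F : PFilt S | s ∈ F.1 ∧ F.1 ∩ T = ∅}}

/-- The set of idempotent proper filters in `S`. -/
abbrev IPFilt (S : Type*) [InvSemigroupWithZero S] :=
  {F : Set S // IsPFilt F ∧ (F ∩ E S).Nonempty}

/-- The subspace topology induced by the patch topology on proper filters. -/
instance : TopologicalSpace (IPFilt S) :=
  TopologicalSpace.induced (fun F => (⟨F.1, F.2.1⟩ : PFilt S)) inferInstance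

/-- The set of `E`-filters. -/
abbrev EFilt (S : Type*) [InvSemigroupWithZero S] := {ξ : Set S // IsEFilt ξ}

/-- The patch topology on the set of `E`-filters, generated by the sets
`P(e;X) = {ξ : e ∈ ξ, ξ ∩ X = ∅}` for `e ∈ E` and finite `X ⊆ ↓e ∩ E`. -/
instance : TopologicalSpace (EFilt S) :=
  TopologicalSpace.generateFrom
    {O : Set (EFilt S) | ∃ (e : S) (X : Set S), e ∈ E S ∧ X.Finite ∧ X ⊆ edwn e ∧
      O = {ξ : EFilt S | e ∈ ξ.1 ∧ ξ.1 ∩ X = ∅}}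

/-- The set of ultrafilters in `S`. -/
abbrev UFilt (S : Type*) [InvSemigroupWithZero S] := {U : Set S // IsUltra U}

/-- The subspace topology induced by the patch topology on proper filters. -/
instance : TopologicalSpace (UFilt S) :=
  TopologicalSpace.induced (fun U => (⟨U.1, U.2.1⟩ : PFilt S)) inferInstance

end InvSemigroupWithZero

namespace InvSemigroupWithZero

variable {S : Type*} [InvSemigroupWithZero S]

theorem inv_eq_of_mem_E {e : S} (he : e ∈ E S) : e⁻¹ = e := by
  have he : e * e = e := he
  exact (inv_unique e e (by rw [he, he]) (by rw [he, he])).symm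

theorem mul_mem_E {e f : S} (he : e ∈ E S) (hf : f ∈ E S) : e * f ∈ E S := by
  have he' : ∀ z, e * (e * z) = e * z := fun z => by rw [← mul_assoc, show e * e = e from he]
  have hf' : ∀ z, f * (f * z) = f * z := fun z => by rw [← mul_assoc, show f * f = f from hf]
  have h1 := mul_inv_mul (e * f)
  have h2 := inv_mul_inv (e * f)
  have h3 := inv_unique (e * f)⁻¹ (e * f) h2 h1
  generalize (e * f)⁻¹ = x at h1 h2 h3
  have hx : f * x * e = x := by
    have hinv : ∀ y, e * f * y * (e * f) = e * f → y * (e * f) * y = y → y = x := by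
      intro y hy hy'
      rw [inv_unique _ _ hy hy', inv_unique _ _ h1 h2]
    apply hinv
    · simpa only [mul_assoc, he', hf'] using h1
    · have h := congrArg (fun z => f * z * e) h2
      simpa only [mul_assoc, he', hf'] using h
  have hxx : x ∈ E S := by
    have h : f * x * e * (f * x * e) = f * x * e := by
      have h := congrArg (fun z => f * z * e) h2
      simpa only [mul_assoc] using h
    rwa [hx] at h
  rw [h3, inv_eq_of_mem_E hxx]
  exact hxx

theorem mul_comm_of_mem_E {e f : S} (he : e ∈ E S) (hf : f ∈ E S) : e * f = f * e := by
  have he' : ∀ z, e * (e * z) = e * z := fun z => by rw [← mul_assoc, show e * e = e from he]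
  have hf' : ∀ z, f * (f * z) = f * z := fun z => by rw [← mul_assoc, show f * f = f from hf]
  have hef : e * f * (e * f) = e * f := mul_mem_E he hf
  have hfe : f * e * (f * e) = f * e := mul_mem_E hf he
  rw [inv_unique (e * f) (f * e), inv_eq_of_mem_E (mul_mem_E he hf)]
  · simpa only [mul_assoc, he', hf'] using hef
  · simpa only [mul_assoc, he', hf'] using hfe

theorem mul_inv_mem_E (a : S) : a * a⁻¹ ∈ E S := by
  change a * a⁻¹ * (a * a⁻¹) = a * a⁻¹
  rw [← mul_assoc, mul_inv_mul]

theorem sle_refl (a : S) : sle a a := (mul_inv_mul a).symm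

theorem sle_trans {a b c : S} (hab : sle a b) (hbc : sle b c) : sle a c := by
  have hcomm := mul_comm_of_mem_E (mul_inv_mem_E a) (mul_inv_mem_E b)
  have hba : b * b⁻¹ * a = a := by
    calc b * b⁻¹ * a = b * b⁻¹ * (a * a⁻¹ * b) := by rw [← hab]
      _ = a * a⁻¹ * (b * b⁻¹ * b) := by rw [← mul_assoc, ← hcomm, mul_assoc]
      _ = a := by rw [mul_inv_mul, ← hab]
  calc a = a * a⁻¹ * b := hab
    _ = a * a⁻¹ * (b * b⁻¹ * c) := by rw [← hbc]
    _ = b * b⁻¹ * a * a⁻¹ * c := by rw [← mul_assoc, hcomm, ← mul_assoc]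
    _ = a * a⁻¹ * c := by rw [hba]

theorem mem_E_of_sle {a e : S} (he : e ∈ E S) (h : sle a e) : a ∈ E S := by
  rw [h]
  exact mul_mem_E (mul_inv_mem_E a) he

theorem sle_iff_ele {e f : S} (he : e ∈ E S) : sle e f ↔ ele e f := by
  rw [sle, ele, inv_eq_of_mem_E he, show e * e = e from he]

theorem subset_up (A : Set S) : A ⊆ up A := fun a ha => ⟨a, ha, sle_refl a⟩

theorem up_mono {A B : Set S} (h : A ⊆ B) : up A ⊆ up B :=
  fun _ ⟨a, ha, hab⟩ => ⟨a, h ha, hab⟩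

theorem IsFilt.mem_of_sle {F : Set S} (hF : IsFilt F) {a b : S} (ha : a ∈ F) (h : sle a b) :
    b ∈ F := hF.2.1 ▸ (⟨a, ha, h⟩ : b ∈ up F)

theorem IsFilt.up_inter_E {F : Set S} (hF : IsFilt F) (hne : (F ∩ E S).Nonempty) :
    up (F ∩ E S) = F := by
  apply Set.Subset.antisymm
  · rintro b ⟨a, ha, hab⟩
    exact hF.mem_of_sle ha.1 hab
  · intro a ha
    obtain ⟨e, heF, he⟩ := hne
    obtain ⟨c, hc, hca, hce⟩ := hF.2.2 a ha e heF
    exact ⟨c, ⟨hc, mem_E_of_sle he hce⟩, hca⟩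

theorem IsPFilt.isEFilt_inter_E {F : Set S} (hF : IsPFilt F) (hne : (F ∩ E S).Nonempty) :
    IsEFilt (F ∩ E S) := by
  refine ⟨Set.inter_subset_right, hne, ?_, ?_, fun h => hF.2 h.1⟩
  · apply Set.Subset.antisymm
    · rintro f ⟨hf, a, ha, haf⟩
      exact ⟨hF.1.mem_of_sle ha.1 ((sle_iff_ele ha.2).2 haf), hf⟩
    · exact fun f hf => ⟨hf.2, f, hf, (sle_iff_ele hf.2).1 (sle_refl f)⟩
  · intro a ha b hb
    obtain ⟨c, hc, hca, hcb⟩ := hF.1.2.2 a ha.1 b hb.1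
    have hcE := mem_E_of_sle ha.2 hca
    exact ⟨c, ⟨hc, hcE⟩, (sle_iff_ele hcE).1 hca, (sle_iff_ele hcE).1 hcb⟩

theorem IsEFilt.up_inter_E {ξ : Set S} (hξ : IsEFilt ξ) : up ξ ∩ E S = ξ := by
  obtain ⟨hE, -, hup, -, -⟩ := hξ
  apply Set.Subset.antisymm
  · rintro f ⟨⟨a, ha, haf⟩, hf⟩
    rw [← hup]
    exact ⟨hf, a, ha, (sle_iff_ele (hE ha)).1 haf⟩
  · exact fun f hf => ⟨subset_up ξ hf, hE hf⟩

theorem IsEFilt.isPFilt_up {ξ : Set S} (hξ : IsEFilt ξ) : IsPFilt (up ξ) := by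
  obtain ⟨hE, hne, -, hdir, h0⟩ := hξ
  refine ⟨⟨hne.mono (subset_up ξ), ?_, ?_⟩, ?_⟩
  · refine Set.Subset.antisymm ?_ (subset_up _)
    rintro c ⟨b, ⟨a, ha, hab⟩, hbc⟩
    exact ⟨a, ha, sle_trans hab hbc⟩
  · rintro a ⟨e, he, hea⟩ b ⟨f, hf, hfb⟩
    obtain ⟨c, hc, hce, hcf⟩ := hdir e he f hf
    have hcE := hE hc
    exact ⟨c, subset_up ξ hc, sle_trans ((sle_iff_ele hcE).2 hce) hea,
      sle_trans ((sle_iff_ele hcE).2 hcf) hfb⟩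
  · rintro ⟨a, ha, ha0⟩
    rw [sle, mul_zero] at ha0
    exact h0 (ha0 ▸ ha)

theorem IsUltra.isEUltra_inter_E {U : Set S} (hU : IsUltra U) (hne : (U ∩ E S).Nonempty) :
    IsEUltra (U ∩ E S) := by
  refine ⟨hU.1.isEFilt_inter_E hne, fun η hη h => ?_⟩
  have hsub : U ⊆ up η := by
    rw [← hU.1.1.up_inter_E hne]
    exact up_mono h
  rw [hU.2 _ hη.isPFilt_up hsub, hη.up_inter_E]

theorem IsEUltra.isUltra_up {ξ : Set S} (hξ : IsEUltra ξ) : IsUltra (up ξ) := by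
  refine ⟨hξ.1.isPFilt_up, fun G hG h => ?_⟩
  have hsub : ξ ⊆ G ∩ E S := Set.subset_inter ((subset_up ξ).trans h) hξ.1.1
  have hne := hξ.1.2.1.mono hsub
  rw [hξ.2 _ (hG.isEFilt_inter_E hne) hsub, hG.1.up_inter_E hne]

end InvSemigroupWithZero

open InvSemigroupWithZero

/-- `ε(F) = F ∩ E` restricts to a bijection from the idempotent ultrafilters
of `S` onto the `E`-ultrafilters. -/
theorem stmt_4 {S : Type*} [InvSemigroupWithZero S] :
    (∀ U : Set S, IsUltra U → (U ∩ E S).Nonempty → IsEUltra (U ∩ E S)) ∧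
    (∀ ξ : Set S, IsEUltra ξ →
      ∃! U : Set S, (IsUltra U ∧ (U ∩ E S).Nonempty) ∧ U ∩ E S = ξ) := by
  refine ⟨fun U hU hne => hU.isEUltra_inter_E hne, fun ξ hξ => ?_⟩
  refine ⟨up ξ, ⟨⟨hξ.isUltra_up, ?_⟩, hξ.1.up_inter_E⟩, ?_⟩
  · rw [hξ.1.up_inter_E]
    exact hξ.1.2.1
  · rintro U ⟨⟨hU, hne⟩, rfl⟩
    exact (hU.1.1.up_inter_E hne).symm
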